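/- Fix 0 < α < 1 and a ≥ 2^α(2+α)/(1−α). Then the cone C₂ := {f ∈ C₁ ∩ L¹(m) : f(x) ≤ a x^{-α} m(f) for all x ∈ (0,1]} is invariant under the transfer operator P_β for every 0 < β ≤ α; that is, if f ∈ C₂ then P_β f ∈ C₂. -/

import Mathlib

open MeasureTheory Set

/-- The Pomeau–Manneville type map `T_β` on `[0,1]` (identified with the circle `S¹`):
`T_β x = x + 3^β/2^(1+β) x^(1+β)` for `x ≤ 2/3` and `T_β x = 3x - 2` otherwise. -/
noncomputable def Tmap (β x : ℝ) : ℝ :=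
  if x ≤ 2/3 then x + (3:ℝ)^β / 2^(1+β) * x^(1+β) else 3*x - 2

/-- The derivative of `T_β` (left-branch formula at `x ≤ 2/3`). -/
noncomputable def Tderiv (β x : ℝ) : ℝ :=
  if x ≤ 2/3 then 1 + (3:ℝ)^β / 2^(1+β) * (1+β) * x^β else 3

/-- The second derivative of `T_β`. -/
noncomputable def Tderiv2 (β x : ℝ) : ℝ :=
  if x ≤ 2/3 then (3:ℝ)^β / 2^(1+β) * (1+β) * β * x^(β-1) else 0

/-- The inverse of the left branch of `T_β` (for `x ∈ [0,1]` this is the unique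
`y ∈ [0,2/3]` with `T_β y = x`). -/
noncomputable def leftInv (β x : ℝ) : ℝ :=
  sSup {y : ℝ | y ∈ Set.Icc (0:ℝ) (2/3) ∧ Tmap β y ≤ x}

/-- The Perron–Frobenius transfer operator of `T_β` with respect to Lebesgue measure:
`P_β f (x) = ∑_{y ∈ T_β⁻¹ x} f y / T_β' y`; the right branch preimage of `x` is `(x+2)/3`,
where the derivative is `3`. -/
noncomputable def Pop (β : ℝ) (f : ℝ → ℝ) (x : ℝ) : ℝ :=
  f (leftInv β x) / Tderiv β (leftInv β x) + f ((x+2)/3) / 3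

/-- `P_{β_{k+n}} ∘ ⋯ ∘ P_{β_{k+1}}`. -/
noncomputable def PopCompFrom (β : ℕ → ℝ) (k : ℕ) : ℕ → (ℝ → ℝ) → ℝ → ℝ
  | 0, f => f
  | n+1, f => Pop (β (k+n+1)) (PopCompFrom β k n f)

/-- `P_{β_n} ∘ ⋯ ∘ P_{β_1}`. -/
noncomputable def PopComp (β : ℕ → ℝ) (n : ℕ) : (ℝ → ℝ) → ℝ → ℝ :=
  PopCompFrom β 0 n

/-- `T_{β_{k+n}} ∘ ⋯ ∘ T_{β_{k+1}}`. -/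
noncomputable def TcompFrom (β : ℕ → ℝ) (k : ℕ) : ℕ → ℝ → ℝ
  | 0, x => x
  | n+1, x => Tmap (β (k+n+1)) (TcompFrom β k n x)

/-- The derivative `(T_{β_{k+n}} ∘ ⋯ ∘ T_{β_{k+1}})'(z)`, computed as the product of the
derivatives along the orbit of `z`. -/
noncomputable def DcompFrom (β : ℕ → ℝ) (k n : ℕ) (z : ℝ) : ℝ :=
  ∏ i ∈ Finset.range n, Tderiv (β (k+i+1)) (TcompFrom β k i z)

/-- The averaging operator `A_ε f (x) = (1/(2ε)) ∫_{B_ε(x)} f dm` on the circle,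
realized via the 1-periodic extension of `f`. -/
noncomputable def Aop (ε : ℝ) (f : ℝ → ℝ) (x : ℝ) : ℝ :=
  (1/(2*ε)) * ∫ t in (x-ε)..(x+ε), f (Int.fract t)

/-- The indicator function of the ball `B_ε(z)` of radius `ε` around `z` in the circle `ℝ/ℤ`. -/
noncomputable def ballInd (ε z : ℝ) : ℝ → ℝ :=
  Set.indicator {y : ℝ | ∃ k : ℤ, |y - z - (k:ℝ)| < ε} (fun _ => 1)

/-- The cone `C₁ = {f ∈ C⁰((0,1]) : f ≥ 0, f decreasing, x ↦ x^(α+1) f x increasing}`. -/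
def memC1 (α : ℝ) (f : ℝ → ℝ) : Prop :=
  ContinuousOn f (Set.Ioc 0 1) ∧ (∀ x ∈ Set.Ioc (0:ℝ) 1, 0 ≤ f x) ∧
  AntitoneOn f (Set.Ioc 0 1) ∧ MonotoneOn (fun x : ℝ => x^(α+1) * f x) (Set.Ioc 0 1)

/-- `m(f) = ∫₀¹ f dm` (Lebesgue). -/
noncomputable def mInt (f : ℝ → ℝ) : ℝ := ∫ x in Set.Ioc (0:ℝ) 1, f x

/-- The cone `C₂ = {f ∈ C₁ ∩ L¹(m) : f x ≤ a x^(-α) m(f)}`. -/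
def memC2 (α a : ℝ) (f : ℝ → ℝ) : Prop :=
  memC1 α f ∧ IntegrableOn f (Set.Ioc 0 1) volume ∧
  ∀ x ∈ Set.Ioc (0:ℝ) 1, f x ≤ a * x^(-α) * mInt f

/-- The `L¹(m)` norm on `[0,1]`. -/
noncomputable def L1norm (f : ℝ → ℝ) : ℝ := ∫ x in Set.Ioc (0:ℝ) 1, |f x|

/-- The `C¹` norm `‖f‖_∞ + ‖f'‖_∞` on the circle. -/
noncomputable def C1norm (f : ℝ → ℝ) : ℝ :=
  (⨆ x : Set.Icc (0:ℝ) 1, |f (x:ℝ)|) + ⨆ x : Set.Icc (0:ℝ) 1, |deriv f (x:ℝ)|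

/-- The relative displacement `T_β y / y - 1 = (3y/2)^β / 2` of the left branch of `T_β`. -/
noncomputable def relDisp (β y : ℝ) : ℝ := (3 * y / 2) ^ β / 2

lemma relDisp_eq {β y : ℝ} (hy : 0 ≤ y) :
    (3:ℝ) ^ β / 2 ^ (1 + β) * y ^ β = relDisp β y := by
  rw [relDisp, Real.div_rpow (by positivity) (by norm_num),
    Real.mul_rpow (by norm_num) hy, Real.rpow_add (by norm_num), Real.rpow_one]
  field_simp

lemma relDisp_nonneg {β y : ℝ} (hy : 0 ≤ y) : 0 ≤ relDisp β y := by
  unfold relDisp; positivity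

lemma relDisp_mono {β y z : ℝ} (hβ : 0 < β) (hy : 0 ≤ y) (hyz : y ≤ z) :
    relDisp β y ≤ relDisp β z := by
  unfold relDisp; gcongr

lemma relDisp_le_half {β y : ℝ} (hβ : 0 < β) (hy : 0 ≤ y) (hy' : y ≤ 2 / 3) :
    relDisp β y ≤ 1 / 2 := by
  have : (3 * y / 2) ^ β ≤ 1 := Real.rpow_le_one (by positivity) (by linarith) hβ.le
  unfold relDisp; linarith

lemma Tmap_left {β y : ℝ} (hβ : 0 < β) (hy : 0 ≤ y) (hy' : y ≤ 2 / 3) :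
    Tmap β y = y * (1 + relDisp β y) := by
  rw [Tmap, if_pos hy', ← relDisp_eq hy, Real.rpow_add' hy (by linarith), Real.rpow_one]
  ring

lemma Tderiv_left {β y : ℝ} (hy : 0 ≤ y) (hy' : y ≤ 2 / 3) :
    Tderiv β y = 1 + (1 + β) * relDisp β y := by
  rw [Tderiv, if_pos hy', ← relDisp_eq hy]
  ring

lemma one_le_Tderiv {β y : ℝ} (hβ : 0 < β) (hy : 0 ≤ y) (hy' : y ≤ 2 / 3) :
    1 ≤ Tderiv β y := by
  rw [Tderiv_left hy hy']
  have := relDisp_nonneg (β := β) hy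
  nlinarith

/-- The left branch is expanding. -/
lemma sub_le_Tmap_sub {β y z : ℝ} (hβ : 0 < β) (hy : 0 ≤ y) (hyz : y ≤ z) (hz : z ≤ 2 / 3) :
    z - y ≤ Tmap β z - Tmap β y := by
  rw [Tmap_left hβ hy (hyz.trans hz), Tmap_left hβ (hy.trans hyz) hz]
  have := mul_le_mul hyz (relDisp_mono hβ hy hyz) (relDisp_nonneg hy) (hy.trans hyz)
  linarith

lemma Tmap_le_Tmap_iff {β y z : ℝ} (hβ : 0 < β) (hy : y ∈ Icc (0:ℝ) (2 / 3))
    (hz : z ∈ Icc (0:ℝ) (2 / 3)) : Tmap β y ≤ Tmap β z ↔ y ≤ z := by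
  constructor
  · intro h
    by_contra! hlt
    linarith [sub_le_Tmap_sub hβ hz.1 hlt.le hy.2]
  · intro h
    linarith [sub_le_Tmap_sub hβ hy.1 h hz.2]

lemma leftInv_Tmap {β y : ℝ} (hβ : 0 < β) (hy : y ∈ Icc (0:ℝ) (2 / 3)) :
    leftInv β (Tmap β y) = y := by
  have : {z : ℝ | z ∈ Icc (0:ℝ) (2 / 3) ∧ Tmap β z ≤ Tmap β y} = Icc 0 y := by
    ext z
    constructor
    · rintro ⟨hz, h⟩
      exact ⟨hz.1, (Tmap_le_Tmap_iff hβ hz hy).1 h⟩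
    · rintro ⟨h0, h1⟩
      have hz : z ∈ Icc (0:ℝ) (2 / 3) := ⟨h0, h1.trans hy.2⟩
      exact ⟨hz, (Tmap_le_Tmap_iff hβ hz hy).2 h1⟩
  rw [leftInv, this, csSup_Icc hy.1]

lemma Tmap_zero {β : ℝ} (hβ : 0 < β) : Tmap β 0 = 0 := by
  rw [Tmap_left hβ le_rfl (by norm_num), zero_mul]

lemma Tmap_two_thirds {β : ℝ} (hβ : 0 < β) : Tmap β (2 / 3) = 1 := by
  rw [Tmap_left hβ (by norm_num) le_rfl, relDisp]
  norm_num

lemma continuousOn_Tmap {β : ℝ} (hβ : 0 < β) : ContinuousOn (Tmap β) (Icc 0 (2 / 3)) := by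
  have : ContinuousOn (fun y => y * (1 + relDisp β y)) (Icc 0 (2 / 3)) := by
    unfold relDisp
    have : Continuous fun y : ℝ => (3 * y / 2) ^ β :=
      Continuous.rpow_const (by fun_prop) fun _ => Or.inr hβ.le
    fun_prop
  exact this.congr fun y hy => Tmap_left hβ hy.1 hy.2

lemma Tmap_image {β : ℝ} (hβ : 0 < β) : Tmap β '' Ioc 0 (2 / 3) = Ioc 0 1 := by
  ext x
  constructor
  · rintro ⟨y, hy, rfl⟩
    have h1 := sub_le_Tmap_sub hβ le_rfl hy.1.le hy.2
    have h2 := sub_le_Tmap_sub hβ hy.1.le hy.2 le_rfl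
    rw [Tmap_zero hβ] at h1
    rw [Tmap_two_thirds hβ] at h2
    exact ⟨by linarith [hy.1], by linarith [hy.2]⟩
  · intro hx
    obtain ⟨y, hy, rfl⟩ := intermediate_value_Icc (by norm_num) (continuousOn_Tmap hβ)
      (show x ∈ Icc (Tmap β 0) (Tmap β (2 / 3)) by
        rw [Tmap_zero hβ, Tmap_two_thirds hβ]; exact ⟨hx.1.le, hx.2⟩)
    refine ⟨y, ⟨lt_of_le_of_ne hy.1 ?_, hy.2⟩, rfl⟩
    rintro rfl
    rw [Tmap_zero hβ] at hx
    exact lt_irrefl _ hx.1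

lemma leftInv_mem {β x : ℝ} (hβ : 0 < β) (hx : x ∈ Ioc (0:ℝ) 1) :
    leftInv β x ∈ Ioc (0:ℝ) (2 / 3) := by
  rw [← Tmap_image hβ] at hx
  obtain ⟨y, hy, rfl⟩ := hx
  rwa [leftInv_Tmap hβ (Ioc_subset_Icc_self hy)]

lemma Tmap_leftInv {β x : ℝ} (hβ : 0 < β) (hx : x ∈ Ioc (0:ℝ) 1) :
    Tmap β (leftInv β x) = x := by
  rw [← Tmap_image hβ] at hx
  obtain ⟨y, hy, rfl⟩ := hx
  rw [leftInv_Tmap hβ (Ioc_subset_Icc_self hy)]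

lemma leftInv_monotoneOn {β : ℝ} (hβ : 0 < β) : MonotoneOn (leftInv β) (Ioc 0 1) := by
  intro x hx y hy hxy
  rwa [← Tmap_le_Tmap_iff hβ (Ioc_subset_Icc_self (leftInv_mem hβ hx))
    (Ioc_subset_Icc_self (leftInv_mem hβ hy)), Tmap_leftInv hβ hx, Tmap_leftInv hβ hy]

lemma continuousOn_leftInv {β : ℝ} (hβ : 0 < β) : ContinuousOn (leftInv β) (Ioc 0 1) := by
  refine (LipschitzOnWith.of_le_add fun x hx y hy => ?_ :
    LipschitzOnWith 1 (leftInv β) (Ioc 0 1)).continuousOn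
  rcases le_total x y with h | h
  · linarith [leftInv_monotoneOn hβ hx hy h, dist_nonneg (x := x) (y := y)]
  · have := sub_le_Tmap_sub hβ (leftInv_mem hβ hy).1.le (leftInv_monotoneOn hβ hy hx h)
      (leftInv_mem hβ hx).2
    rw [Tmap_leftInv hβ hx, Tmap_leftInv hβ hy] at this
    rw [Real.dist_eq, abs_of_nonneg (sub_nonneg.2 h)]
    linarith

lemma hasDerivWithinAt_Tmap {β y : ℝ} (hy : y ∈ Ioc (0:ℝ) (2 / 3)) :
    HasDerivWithinAt (Tmap β) (Tderiv β y) (Ioc 0 (2 / 3)) y := by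
  have h : HasDerivAt (fun y : ℝ => y + (3:ℝ) ^ β / 2 ^ (1 + β) * y ^ (1 + β))
      (Tderiv β y) y := by
    have := (hasDerivAt_id' y).fun_add ((Real.hasDerivAt_rpow_const (p := 1 + β)
      (Or.inl hy.1.ne')).const_mul ((3:ℝ) ^ β / 2 ^ (1 + β)))
    rw [add_sub_cancel_left, ← mul_assoc] at this
    rwa [Tderiv, if_pos hy.2]
  exact h.hasDerivWithinAt.congr (fun z hz => if_pos hz.2) (if_pos hy.2)

lemma third_mem {x : ℝ} (hx : x ∈ Ioc (0:ℝ) 1) : (x + 2) / 3 ∈ Ioc (0:ℝ) 1 :=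
  ⟨by linarith [hx.1], by linarith [hx.2]⟩

lemma leftInv_mem_unit {β x : ℝ} (hβ : 0 < β) (hx : x ∈ Ioc (0:ℝ) 1) :
    leftInv β x ∈ Ioc (0:ℝ) 1 :=
  ⟨(leftInv_mem hβ hx).1, (leftInv_mem hβ hx).2.trans (by norm_num)⟩

lemma Tderiv_leftInv {β x : ℝ} (hβ : 0 < β) (hx : x ∈ Ioc (0:ℝ) 1) :
    Tderiv β (leftInv β x) = 1 + (1 + β) * relDisp β (leftInv β x) :=
  Tderiv_left (leftInv_mem hβ hx).1.le (leftInv_mem hβ hx).2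

lemma one_le_Tderiv_leftInv {β x : ℝ} (hβ : 0 < β) (hx : x ∈ Ioc (0:ℝ) 1) :
    1 ≤ Tderiv β (leftInv β x) :=
  one_le_Tderiv hβ (leftInv_mem hβ hx).1.le (leftInv_mem hβ hx).2

lemma Tderiv_leftInv_mono {β x y : ℝ} (hβ : 0 < β) (hx : x ∈ Ioc (0:ℝ) 1)
    (hy : y ∈ Ioc (0:ℝ) 1) (hxy : x ≤ y) :
    Tderiv β (leftInv β x) ≤ Tderiv β (leftInv β y) := by
  rw [Tderiv_leftInv hβ hx, Tderiv_leftInv hβ hy]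
  have := relDisp_mono hβ (leftInv_mem hβ hx).1.le (leftInv_monotoneOn hβ hx hy hxy)
  gcongr

lemma continuousOn_Pop {β : ℝ} (hβ : 0 < β) {f : ℝ → ℝ} (hf : ContinuousOn f (Ioc 0 1)) :
    ContinuousOn (Pop β f) (Ioc 0 1) := by
  have hT : ContinuousOn (fun x => Tderiv β (leftInv β x)) (Ioc 0 1) := by
    have : ContinuousOn (fun x => 1 + (1 + β) * ((3 * leftInv β x / 2) ^ β / 2)) (Ioc 0 1) := by
      have hr : ContinuousOn (fun x => (3 * leftInv β x / 2) ^ β) (Ioc 0 1) :=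
        ContinuousOn.rpow_const
          (((continuousOn_leftInv hβ).const_mul 3 |>.mul_const (2:ℝ)⁻¹).congr
            fun x _ => by simp [div_eq_mul_inv]) fun _ _ => Or.inr hβ.le
      fun_prop
    exact this.congr fun x hx => Tderiv_leftInv hβ hx
  refine ((hf.comp (continuousOn_leftInv hβ) fun x hx => leftInv_mem_unit hβ hx).div hT
    fun x hx => ?_).add ((hf.comp (by fun_prop) fun x hx => third_mem hx).div_const 3)
  linarith [one_le_Tderiv_leftInv hβ hx]

lemma antitoneOn_Pop {β : ℝ} (hβ : 0 < β) {f : ℝ → ℝ} (h0 : ∀ x ∈ Ioc (0:ℝ) 1, 0 ≤ f x)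
    (hf : AntitoneOn f (Ioc 0 1)) : AntitoneOn (Pop β f) (Ioc 0 1) := by
  intro x hx y hy hxy
  refine add_le_add (div_le_div₀ (h0 _ (leftInv_mem_unit hβ hx))
    (hf (leftInv_mem_unit hβ hx) (leftInv_mem_unit hβ hy) (leftInv_monotoneOn hβ hx hy hxy))
    (by linarith [one_le_Tderiv_leftInv hβ hx]) (Tderiv_leftInv_mono hβ hx hy hxy)) ?_
  have := hf (third_mem hx) (third_mem hy) (by linarith)
  linarith

/-- `u ↦ (1+u)^p / (1+ku)` is monotone on `[0,∞)` for `1 ≤ k ≤ p`. -/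
lemma one_add_rpow_div_mono {k p u v : ℝ} (hk : 1 ≤ k) (hkp : k ≤ p) (hu : 0 ≤ u) (huv : u ≤ v) :
    (1 + u) ^ p / (1 + k * u) ≤ (1 + v) ^ p / (1 + k * v) := by
  have hku : 0 < 1 + k * u := by positivity
  have hkv : 0 < 1 + k * v := by have := hu.trans huv; positivity
  have hb := one_add_mul_self_le_rpow_one_add (s := (v - u) / (1 + u)) (p := p)
    (by have : 0 ≤ (v - u) / (1 + u) := div_nonneg (by linarith) (by linarith)
        linarith) (by linarith)
  have he : 1 + (v - u) / (1 + u) = (1 + v) / (1 + u) := by field_simp; ring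
  rw [he, Real.div_rpow (by linarith) (by linarith)] at hb
  have hl : (1 + k * v) / (1 + k * u) ≤ 1 + p * ((v - u) / (1 + u)) := by
    have e : (1 + k * v) / (1 + k * u) = 1 + k * ((v - u) / (1 + k * u)) := by
      field_simp; ring
    rw [e]
    have : 0 ≤ v - u := by linarith
    gcongr
    · linarith
    · exact le_mul_of_one_le_left hu hk
  have h := hl.trans hb
  rw [div_le_div_iff₀ hku (by positivity)] at h
  rw [div_le_div_iff₀ hku hkv]
  linarith

lemma monotoneOn_rpow_mul_Pop {α β : ℝ} (hβ : 0 < β) (hβα : β ≤ α) {f : ℝ → ℝ}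
    (h0 : ∀ x ∈ Ioc (0:ℝ) 1, 0 ≤ f x)
    (hf : MonotoneOn (fun x : ℝ => x ^ (α + 1) * f x) (Ioc 0 1)) :
    MonotoneOn (fun x : ℝ => x ^ (α + 1) * Pop β f x) (Ioc 0 1) := by
  have hleft : ∀ x ∈ Ioc (0:ℝ) 1, x ^ (α + 1) * (f (leftInv β x) / Tderiv β (leftInv β x)) =
      (leftInv β x ^ (α + 1) * f (leftInv β x)) *
        ((1 + relDisp β (leftInv β x)) ^ (α + 1) /
          (1 + (1 + β) * relDisp β (leftInv β x))) := by
    intro x hx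
    have hm := leftInv_mem hβ hx
    have hu := relDisp_nonneg (β := β) hm.1.le
    have : x ^ (α + 1) = leftInv β x ^ (α + 1) * (1 + relDisp β (leftInv β x)) ^ (α + 1) := by
      rw [← Real.mul_rpow hm.1.le (by linarith), ← Tmap_left hβ hm.1.le hm.2, Tmap_leftInv hβ hx]
    rw [this, Tderiv_leftInv hβ hx]
    ring
  have hright : ∀ x ∈ Ioc (0:ℝ) 1, x ^ (α + 1) * (f ((x + 2) / 3) / 3) =
      (x / ((x + 2) / 3)) ^ (α + 1) * (((x + 2) / 3) ^ (α + 1) * f ((x + 2) / 3)) / 3 := by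
    intro x hx
    have hz := (third_mem hx).1
    rw [Real.div_rpow hx.1.le hz.le]
    have : 0 < ((x + 2) / 3) ^ (α + 1) := by positivity
    field_simp
  intro x hx y hy hxy
  simp only [Pop, mul_add]
  rw [hleft x hx, hleft y hy, hright x hx, hright y hy]
  have hmx := leftInv_mem hβ hx
  have hmy := leftInv_mem hβ hy
  have hux := relDisp_nonneg (β := β) hmx.1.le
  have hmono := leftInv_monotoneOn hβ hx hy hxy
  have hfy := h0 _ (leftInv_mem_unit hβ hy)
  have hfz := h0 _ (third_mem hx)
  have hx0 := hx.1
  have hy0 := hy.1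
  have hzx := (third_mem hx).1
  have hzy := (third_mem hy).1
  refine add_le_add (mul_le_mul (hf (leftInv_mem_unit hβ hx) (leftInv_mem_unit hβ hy) hmono)
    (one_add_rpow_div_mono (by linarith) (by linarith) hux (relDisp_mono hβ hmx.1.le hmono))
    (by positivity) (by have := hmy.1; positivity)) ?_
  have h1 := hf (third_mem hx) (third_mem hy) (by linarith)
  have h2 : (x / ((x + 2) / 3)) ^ (α + 1) ≤ (y / ((y + 2) / 3)) ^ (α + 1) := by
    refine Real.rpow_le_rpow (by positivity) ?_ (by linarith)
    rw [div_le_div_iff₀ hzx hzy]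
    nlinarith
  have h3 := mul_le_mul h2 h1 (by positivity) (by positivity)
  linarith

lemma Pop_nonneg {β : ℝ} (hβ : 0 < β) {f : ℝ → ℝ} (h0 : ∀ x ∈ Ioc (0:ℝ) 1, 0 ≤ f x)
    {x : ℝ} (hx : x ∈ Ioc (0:ℝ) 1) : 0 ≤ Pop β f x := by
  have h1 := h0 _ (leftInv_mem_unit hβ hx)
  have h2 := h0 _ (third_mem hx)
  have h3 := one_le_Tderiv_leftInv hβ hx
  unfold Pop
  positivity

lemma memC1_Pop {α β : ℝ} (hβ : 0 < β) (hβα : β ≤ α) {f : ℝ → ℝ} (hf : memC1 α f) :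
    memC1 α (Pop β f) :=
  ⟨continuousOn_Pop hβ hf.1, fun _ hx => Pop_nonneg hβ hf.2.1 hx,
    antitoneOn_Pop hβ hf.2.1 hf.2.2.1, monotoneOn_rpow_mul_Pop hβ hβα hf.2.1 hf.2.2.2⟩

lemma left_branch_change_of_variables {β : ℝ} (hβ : 0 < β) (f : ℝ → ℝ) :
    (IntegrableOn (fun x => f (leftInv β x) / Tderiv β (leftInv β x)) (Ioc 0 1) ↔
      IntegrableOn f (Ioc 0 (2 / 3))) ∧
    ∫ x in Ioc (0:ℝ) 1, f (leftInv β x) / Tderiv β (leftInv β x) =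
      ∫ y in Ioc (0:ℝ) (2 / 3), f y := by
  have hinj : InjOn (Tmap β) (Ioc 0 (2 / 3)) :=
    (show LeftInvOn (leftInv β) (Tmap β) (Ioc 0 (2 / 3)) from
      fun y hy => leftInv_Tmap hβ (Ioc_subset_Icc_self hy)).injOn
  have he : EqOn (fun y => |Tderiv β y| •
      (f (leftInv β (Tmap β y)) / Tderiv β (leftInv β (Tmap β y)))) f (Ioc 0 (2 / 3)) := by
    intro y hy
    have := one_le_Tderiv hβ hy.1.le hy.2
    simp only [leftInv_Tmap hβ (Ioc_subset_Icc_self hy), smul_eq_mul]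
    rw [abs_of_nonneg (by linarith)]
    field_simp
  rw [← Tmap_image hβ,
    integrableOn_image_iff_integrableOn_abs_deriv_smul measurableSet_Ioc
      (fun y hy => hasDerivWithinAt_Tmap hy) hinj,
    integral_image_eq_integral_abs_deriv_smul measurableSet_Ioc
      (fun y hy => hasDerivWithinAt_Tmap hy) hinj]
  exact ⟨integrableOn_congr_fun he measurableSet_Ioc, setIntegral_congr_fun measurableSet_Ioc he⟩

lemma right_branch_change_of_variables (f : ℝ → ℝ) :
    (IntegrableOn (fun x => f ((x + 2) / 3) / 3) (Ioc 0 1) ↔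
      IntegrableOn f (Ioc (2 / 3) 1)) ∧
    ∫ x in Ioc (0:ℝ) 1, f ((x + 2) / 3) / 3 = ∫ y in Ioc (2 / 3 : ℝ) 1, f y := by
  have himg : (fun y : ℝ => 3 * y - 2) '' Ioc (2 / 3) 1 = Ioc 0 1 := by
    ext x
    constructor
    · rintro ⟨y, hy, rfl⟩
      exact ⟨by linarith [hy.1], by linarith [hy.2]⟩
    · intro hx
      exact ⟨(x + 2) / 3, ⟨by linarith [hx.1], by linarith [hx.2]⟩, by ring⟩
  have hinj : InjOn (fun y : ℝ => 3 * y - 2) (Ioc (2 / 3) 1) := by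
    intro y _ z _ h
    simp only at h
    linarith
  have hd : ∀ y ∈ Ioc (2 / 3 : ℝ) 1,
      HasDerivWithinAt (fun y : ℝ => 3 * y - 2) 3 (Ioc (2 / 3) 1) y := by
    intro y _
    simpa using (((hasDerivAt_id y).const_mul 3).sub_const 2).hasDerivWithinAt
  have he : EqOn (fun y : ℝ => |(3:ℝ)| • (f ((3 * y - 2 + 2) / 3) / 3)) f (Ioc (2 / 3) 1) := by
    intro y _
    simp only [smul_eq_mul, sub_add_cancel]
    rw [abs_of_pos (by norm_num), mul_div_cancel_left₀ _ (by norm_num)]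
    field_simp
  rw [← himg, integrableOn_image_iff_integrableOn_abs_deriv_smul measurableSet_Ioc hd hinj,
    integral_image_eq_integral_abs_deriv_smul measurableSet_Ioc hd hinj]
  exact ⟨integrableOn_congr_fun he measurableSet_Ioc, setIntegral_congr_fun measurableSet_Ioc he⟩

lemma integrableOn_Pop {β : ℝ} (hβ : 0 < β) {f : ℝ → ℝ} (hf : IntegrableOn f (Ioc 0 1)) :
    IntegrableOn (Pop β f) (Ioc 0 1) :=
  ((left_branch_change_of_variables hβ f).1.2
      (hf.mono_set (Ioc_subset_Ioc_right (by norm_num)))).add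
    ((right_branch_change_of_variables f).1.2
      (hf.mono_set (Ioc_subset_Ioc_left (by norm_num))))

/-- The transfer operator preserves the integral. -/
lemma mInt_Pop {β : ℝ} (hβ : 0 < β) {f : ℝ → ℝ} (hf : IntegrableOn f (Ioc 0 1)) :
    mInt (Pop β f) = mInt f := by
  have hl := hf.mono_set (Ioc_subset_Ioc_right (show (2 / 3 : ℝ) ≤ 1 by norm_num))
  have hr := hf.mono_set (Ioc_subset_Ioc_left (show (0:ℝ) ≤ 2 / 3 by norm_num))
  have hL := left_branch_change_of_variables hβ f
  have hR := right_branch_change_of_variables f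
  unfold mInt Pop
  rw [integral_add (hL.1.2 hl) (hR.1.2 hr), hL.2, hR.2,
    ← setIntegral_union (Ioc_disjoint_Ioc_of_le le_rfl) measurableSet_Ioc hl hr,
    Ioc_union_Ioc_eq_Ioc (by norm_num) (by norm_num)]

lemma mul_le_mInt {f : ℝ → ℝ} (h0 : ∀ x ∈ Ioc (0:ℝ) 1, 0 ≤ f x)
    (hanti : AntitoneOn f (Ioc 0 1)) (hf : IntegrableOn f (Ioc 0 1))
    {z : ℝ} (hz : z ∈ Ioc (0:ℝ) 1) : z * f z ≤ mInt f := by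
  have hsub : Ioc 0 z ⊆ Ioc (0:ℝ) 1 := Ioc_subset_Ioc_right hz.2
  calc z * f z = ∫ _ in Ioc 0 z, f z := by simp [hz.1.le]
    _ ≤ ∫ x in Ioc 0 z, f x :=
      setIntegral_mono_on (by simp) (hf.mono_set hsub) measurableSet_Ioc
        fun x hx => hanti (hsub hx) hz hx.2
    _ ≤ mInt f := setIntegral_mono_set hf
      ((ae_restrict_iff' measurableSet_Ioc).2 (Filter.Eventually.of_forall h0))
      (Filter.Eventually.of_forall hsub)

lemma Tmap_rpow_le_relDisp {α β y : ℝ} (hβ : 0 < β) (hβα : β ≤ α)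
    (hy : y ∈ Ioc (0:ℝ) (2 / 3)) : Tmap β y ^ α ≤ 2 * 2 ^ α * relDisp β y := by
  have hy0 := hy.1
  have hu := relDisp_nonneg (β := β) hy0.le
  have h1 : Tmap β y ≤ 2 * (3 * y / 2) := by
    rw [Tmap_left hβ hy0.le hy.2]
    nlinarith [relDisp_le_half hβ hy0.le hy.2]
  have h2 : (0:ℝ) ≤ Tmap β y := by
    rw [Tmap_left hβ hy0.le hy.2]; positivity
  calc Tmap β y ^ α ≤ (2 * (3 * y / 2)) ^ α := Real.rpow_le_rpow h2 h1 (by linarith)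
    _ = 2 ^ α * (3 * y / 2) ^ α := Real.mul_rpow (by norm_num) (by positivity)
    _ ≤ 2 ^ α * (3 * y / 2) ^ β := by
      exact mul_le_mul_of_nonneg_left (Real.rpow_le_rpow_of_exponent_ge (by positivity)
        (by linarith [hy.2]) hβα) (by positivity)
    _ = 2 * 2 ^ α * relDisp β y := by unfold relDisp; ring

/-- The numerical inequality behind the invariance of the bound `f x ≤ a x^(-α) m(f)`. -/
lemma branch_weights_le {α β a u t : ℝ} (hα0 : 0 < α) (hα1 : α < 1)
    (ha : (2:ℝ) ^ α * (2 + α) / (1 - α) ≤ a) (hβ : 0 < β) (hβα : β ≤ α)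
    (hu0 : 0 ≤ u) (hu : u ≤ 1 / 2) (ht : t ≤ 2 * 2 ^ α * u) :
    a * (1 + u) ^ α / (1 + (1 + β) * u) + t / 2 ≤ a := by
  have hD : 0 < 1 + (1 + β) * u := by positivity
  have h1α : 0 < 1 - α := by linarith
  have ha0 : 0 ≤ a := le_trans (by positivity) ha
  rw [div_le_iff₀ h1α] at ha
  have hbern : (1 + u) ^ α ≤ 1 + α * u :=
    rpow_one_add_le_one_add_mul_self (by linarith) hα0.le hα1.le
  have hD2 : 1 + (1 + β) * u ≤ 2 + α := by nlinarith
  have hkey : 2 ^ α * u * (1 + (1 + β) * u) ≤ a * (1 - α) * u := by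
    calc 2 ^ α * u * (1 + (1 + β) * u) ≤ 2 ^ α * u * (2 + α) := by gcongr
      _ = 2 ^ α * (2 + α) * u := by ring
      _ ≤ a * (1 - α) * u := by gcongr
  have h1 : a * (1 + u) ^ α ≤ a * (1 + α * u) := by gcongr
  have h2 : 0 ≤ a * (β * u) := by positivity
  have h3 : a * (1 + u) ^ α / (1 + (1 + β) * u) ≤ a - 2 ^ α * u := by
    rw [div_le_iff₀ hD]
    linarith
  linarith

lemma Pop_le {α a β : ℝ} (hα0 : 0 < α) (hα1 : α < 1)
    (ha : (2:ℝ) ^ α * (2 + α) / (1 - α) ≤ a) (hβ : 0 < β) (hβα : β ≤ α) {f : ℝ → ℝ}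
    (hf : memC2 α a f) {x : ℝ} (hx : x ∈ Ioc (0:ℝ) 1) :
    Pop β f x ≤ a * x ^ (-α) * mInt f := by
  obtain ⟨⟨-, h0, hanti, -⟩, hint, hbd⟩ := hf
  have hm : 0 ≤ mInt f := setIntegral_nonneg measurableSet_Ioc h0
  have hx0 := hx.1
  have hy := leftInv_mem hβ hx
  have hTx := Tmap_leftInv hβ hx
  have hfy := hbd _ (leftInv_mem_unit hβ hx)
  have hz := mul_le_mInt h0 hanti hint (third_mem hx)
  have hfz := h0 _ (third_mem hx)
  have hD := one_le_Tderiv_leftInv hβ hx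
  have hw := Tmap_rpow_le_relDisp hβ hβα hy
  rw [hTx] at hw
  have hxα : 0 < x ^ α := by positivity
  have hu := relDisp_nonneg (β := β) hy.1.le
  have hweights := branch_weights_le hα0 hα1 ha hβ hβα hu (relDisp_le_half hβ hy.1.le hy.2) hw
  rw [← Tderiv_leftInv hβ hx] at hweights
  have hratio : leftInv β x ^ (-α) = x ^ (-α) * (1 + relDisp β (leftInv β x)) ^ α := by
    have hxα' : x ^ α = leftInv β x ^ α * (1 + relDisp β (leftInv β x)) ^ α := by
      rw [← Real.mul_rpow hy.1.le (by linarith), ← Tmap_left hβ hy.1.le hy.2, hTx]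
    have hyα : 0 < leftInv β x ^ α := Real.rpow_pos_of_pos hy.1 α
    have : 0 < (1 + relDisp β (leftInv β x)) ^ α := by positivity
    rw [Real.rpow_neg hy.1.le, Real.rpow_neg hx0.le, hxα']
    field_simp
  have hright : f ((x + 2) / 3) / 3 ≤ mInt f / 2 := by nlinarith
  have hone : x ^ (-α) * x ^ α = 1 := by
    rw [← Real.rpow_add hx0, neg_add_cancel, Real.rpow_zero]
  calc Pop β f x
      ≤ a * leftInv β x ^ (-α) * mInt f / Tderiv β (leftInv β x) + mInt f / 2 := by
        unfold Pop; gcongr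
    _ = x ^ (-α) * mInt f * (a * (1 + relDisp β (leftInv β x)) ^ α / Tderiv β (leftInv β x)
          + x ^ α / 2) := by
        rw [hratio]
        linear_combination (-(mInt f / 2)) * hone
    _ ≤ x ^ (-α) * mInt f * a := by gcongr
    _ = a * x ^ (-α) * mInt f := by ring

/-- For `0 < α < 1` and `a ≥ 2^α(2+α)/(1-α)`, the cone `C₂` is invariant
under the transfer operator `P_β` for every `0 < β ≤ α`. -/
theorem cone_C2_invariant (α a β : ℝ) (hα0 : 0 < α) (hα1 : α < 1)
    (ha : (2:ℝ)^α * (2+α) / (1-α) ≤ a)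
    (hβ0 : 0 < β) (hβα : β ≤ α) (f : ℝ → ℝ) (hf : memC2 α a f) :
    memC2 α a (Pop β f) := by
  refine ⟨memC1_Pop hβ0 hβα hf.1, integrableOn_Pop hβ0 hf.2.1, fun x hx => ?_⟩
  rw [mInt_Pop hβ0 hf.2.1]
  exact Pop_le hα0 hα1 ha hβ0 hβα hf hx
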